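/- Every zero of E_2 in H is simple: if a ∈ H and E_2(a) = 0, then E_2'(a) ≠ 0. -/

import Mathlib

/-- The normalized Eisenstein series of even weight `k ≥ 4` (the definition also
makes sense for `k = 2`, giving the quasi-modular Eisenstein series `E₂`), defined by
its Fourier expansion `E_k(z) = 1 - (2k/B_k) ∑_{n≥1} σ_{k-1}(n) qⁿ`, `q = exp(2πiz)`. -/
noncomputable def Ek (k : ℕ) (z : ℂ) : ℂ :=
  1 - (2 * (k : ℂ) / ((bernoulli k : ℚ) : ℂ)) *
    ∑' n : ℕ, (∑ d ∈ n.divisors, (d : ℂ) ^ (k - 1)) * Complex.exp (2 * Real.pi * Complex.I * z) ^ n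

open Complex EisensteinSeries ModularGroup
open UpperHalfPlane hiding I
open scoped ArithmeticFunction.sigma MatrixGroups ModularForm Derivative

/-- The generating function `∑ σ₁(n) qⁿ` of the divisor sums. -/
noncomputable def sigmaSeries (q : ℂ) : ℂ := ∑' n : ℕ, (σ 1 n : ℂ) * q ^ n

/-- The generating function `∑ n σ₁(n) qⁿ`, the Euler derivative of `sigmaSeries`. -/
noncomputable def eulerSigmaSeries (q : ℂ) : ℂ := ∑' n : ℕ, (n * σ 1 n : ℂ) * q ^ n

lemma norm_sigma_one_le (n : ℕ) : ‖(σ 1 n : ℂ)‖ ≤ (n : ℝ) ^ 2 := by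
  rw [Complex.norm_natCast]
  exact_mod_cast ArithmeticFunction.sigma_le_pow_succ 1 n

lemma Ek_two_eq_sigmaSeries (z : ℂ) :
    Ek 2 z = 1 - 24 * sigmaSeries (cexp (2 * Real.pi * I * z)) := by
  have h : (2 * ((2 : ℕ) : ℂ) / ((bernoulli 2 : ℚ) : ℂ)) = 24 := by
    rw [bernoulli_two]; norm_num
  rw [Ek, h, sigmaSeries]
  simp [ArithmeticFunction.sigma_apply]

lemma Ek_two_eq_E2 (z : ℍ) : Ek 2 z = E2 z := by
  rw [Ek_two_eq_sigmaSeries, E2_eq_tsum_cexp, sigmaSeries,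
    ← tsum_zero_pnat_eq_tsum_nat (summable_sigma_mul_cexp_pow (k := 2) one_le_two z)]
  simp

lemma summable_pow_mul_norm_pow {q : ℂ} (hq : ‖q‖ < 1) (k : ℕ) :
    Summable fun n : ℕ ↦ (n : ℝ) ^ k * ‖q‖ ^ n :=
  summable_pow_mul_geometric_of_norm_lt_one k (by simpa using hq)

lemma summable_sigmaSeries {q : ℂ} (hq : ‖q‖ < 1) : Summable fun n : ℕ ↦ (σ 1 n : ℂ) * q ^ n := by
  refine .of_norm_bounded (summable_pow_mul_norm_pow hq 2) fun n ↦ ?_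
  rw [norm_mul, norm_pow]
  gcongr
  exact norm_sigma_one_le n

lemma norm_natCast_mul_sigma_one_le (n : ℕ) : ‖(n * σ 1 n : ℂ)‖ ≤ (n : ℝ) ^ 3 := by
  rw [norm_mul, Complex.norm_natCast, pow_succ']
  gcongr
  exact norm_sigma_one_le n

lemma summable_eulerSigmaSeries {q : ℂ} (hq : ‖q‖ < 1) :
    Summable fun n : ℕ ↦ (n * σ 1 n : ℂ) * q ^ n := by
  refine .of_norm_bounded (summable_pow_mul_norm_pow hq 3) fun n ↦ ?_
  rw [norm_mul, norm_pow]
  gcongr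
  exact norm_natCast_mul_sigma_one_le n

lemma hasDerivAt_sigmaSeries {q : ℂ} (hq : ‖q‖ < 1) (hq0 : q ≠ 0) :
    HasDerivAt sigmaSeries (eulerSigmaSeries q / q) q := by
  obtain ⟨r, hqr, hr1⟩ := exists_between hq
  have hr0 : 0 < r := (norm_nonneg q).trans_lt hqr
  have hq_mem : q ∈ Metric.ball (0 : ℂ) r := by simpa using hqr
  have hr_norm : ‖r‖ < 1 := by rwa [Real.norm_of_nonneg hr0.le]
  have hsum : Summable fun n : ℕ ↦ (n : ℝ) ^ 3 * r ^ n * r⁻¹ :=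
    (summable_pow_mul_geometric_of_norm_lt_one 3 hr_norm).mul_right _
  have hterm (n : ℕ) (x : ℂ) : HasDerivAt (fun x : ℂ ↦ (σ 1 n : ℂ) * x ^ n)
      ((n * σ 1 n : ℂ) * x ^ (n - 1)) x := by
    rw [mul_comm (n : ℂ), mul_assoc]
    exact (hasDerivAt_pow n x).const_mul _
  have hbound (n : ℕ) (x : ℂ) (hx : x ∈ Metric.ball (0 : ℂ) r) :
      ‖(n * σ 1 n : ℂ) * x ^ (n - 1)‖ ≤ (n : ℝ) ^ 3 * r ^ n * r⁻¹ := by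
    have hx' : ‖x‖ ≤ r := (mem_ball_zero_iff.mp hx).le
    rcases n.eq_zero_or_pos with rfl | hn
    · simp
    · rw [norm_mul, norm_pow, mul_assoc,
        ← pow_sub_one_mul hn.ne' r, mul_inv_cancel_right₀ hr0.ne']
      gcongr
      exact norm_natCast_mul_sigma_one_le n
  have hvalue : eulerSigmaSeries q / q = ∑' n : ℕ, (n * σ 1 n : ℂ) * q ^ (n - 1) := by
    rw [eulerSigmaSeries, ← tsum_div_const]
    refine tsum_congr fun n ↦ ?_
    rcases n.eq_zero_or_pos with rfl | hn
    · simp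
    · rw [← pow_sub_one_mul hn.ne' q, ← mul_assoc, mul_div_cancel_right₀ _ hq0]
  rw [hvalue]
  exact hasDerivAt_tsum_of_isPreconnected hsum Metric.isOpen_ball
    (convex_ball (0 : ℂ) r).isPreconnected (fun n x _ ↦ hterm n x) hbound hq_mem
    (summable_sigmaSeries hq) hq_mem

lemma hasDerivAt_Ek_two (z : ℍ) :
    HasDerivAt (Ek 2)
      (-24 * (2 * Real.pi * I) * eulerSigmaSeries (cexp (2 * Real.pi * I * z))) z := by
  have hexp : HasDerivAt (fun x : ℂ ↦ cexp (2 * Real.pi * I * x))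
      (cexp (2 * Real.pi * I * z) * (2 * Real.pi * I)) z := by
    simpa using ((hasDerivAt_id (z : ℂ)).const_mul (2 * Real.pi * I : ℂ)).cexp
  have h := (((hasDerivAt_sigmaSeries (norm_exp_two_pi_I_lt_one z) (exp_ne_zero _)).comp (z : ℂ)
    hexp).const_mul 24).const_sub 1
  convert! h using 1
  · ext x
    exact Ek_two_eq_sigmaSeries x
  · have := exp_ne_zero (2 * Real.pi * I * z)
    field_simp

lemma Ek_two_eventuallyEq (z : ℍ) : E2 ∘ ofComplex =ᶠ[nhds (z : ℂ)] Ek 2 := by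
  filter_upwards [isOpen_upperHalfPlaneSet.mem_nhds z.im_pos] with x hx
  rw [Function.comp_apply, ofComplex_apply_of_im_pos hx, ← Ek_two_eq_E2]

lemma normalizedDeriv_E2_eq (z : ℍ) : D E2 z = (2 * Real.pi * I)⁻¹ * deriv (Ek 2) z := by
  rw [Derivative.normalizedDerivOfComplex, (Ek_two_eventuallyEq z).deriv_eq]

lemma normalizedDeriv_E2_eq_eulerSigmaSeries (z : ℍ) :
    D E2 z = -24 * eulerSigmaSeries (cexp (2 * Real.pi * I * z)) := by
  rw [normalizedDeriv_E2_eq, (hasDerivAt_Ek_two z).deriv]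
  field_simp [two_pi_I_ne_zero]

/-- A power series with coefficients bounded by a geometric sequence is close to its first-order
truncation. -/
lemma norm_tsum_sub_linear_le {a : ℕ → ℂ} {C K : ℝ} {q : ℂ} (hK : 0 ≤ K)
    (ha : ∀ n, ‖a (n + 2)‖ ≤ C * K ^ n) (hs : Summable fun n ↦ a n * q ^ n) (hq : K * ‖q‖ < 1) :
    ‖∑' n, a n * q ^ n - (a 0 + a 1 * q)‖ ≤ C * ‖q‖ ^ 2 / (1 - K * ‖q‖) := by
  rw [← hs.sum_add_tsum_nat_add 2]
  simp only [Finset.sum_range_succ, Finset.sum_range_zero, pow_zero, pow_one, mul_one, zero_add,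
    add_sub_cancel_left]
  have hgeo := (hasSum_geometric_of_lt_one (by positivity : 0 ≤ K * ‖q‖) hq).mul_left
    (C * ‖q‖ ^ 2)
  rw [div_eq_mul_inv]
  refine tsum_of_norm_bounded hgeo fun n ↦ ?_
  calc ‖a (n + 2) * q ^ (n + 2)‖ = ‖a (n + 2)‖ * ‖q‖ ^ (n + 2) := by rw [norm_mul, norm_pow]
    _ ≤ (C * K ^ n) * ‖q‖ ^ (n + 2) := by gcongr; exact ha n
    _ = C * ‖q‖ ^ 2 * (K * ‖q‖) ^ n := by ring

lemma natCast_add_two_le (n : ℕ) : ((n + 2 : ℕ) : ℝ) ≤ 2 * 2 ^ n := by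
  have h : n + 2 ≤ 2 * 2 ^ n := by
    have := n.lt_two_pow_self
    omega
  exact_mod_cast h

lemma norm_sigmaSeries_sub_le {q : ℂ} (hq : ‖q‖ ≤ 1 / 200) :
    ‖sigmaSeries q - q‖ ≤ 5 * ‖q‖ ^ 2 := by
  have h := norm_tsum_sub_linear_le (a := fun n ↦ (σ 1 n : ℂ)) (C := 4) (K := 4) (q := q)
    (by norm_num) (fun n ↦ ?_) (summable_sigmaSeries (by linarith)) (by linarith)
  · simp only [ArithmeticFunction.map_zero, Nat.cast_zero, ArithmeticFunction.sigma_one,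
      Nat.cast_one, zero_add, one_mul] at h
    refine h.trans ?_
    rw [div_le_iff₀ (by linarith)]
    nlinarith [sq_nonneg ‖q‖]
  · calc ‖(σ 1 (n + 2) : ℂ)‖ ≤ ((n + 2 : ℕ) : ℝ) ^ 2 := norm_sigma_one_le (n + 2)
      _ ≤ (2 * 2 ^ n) ^ 2 := by gcongr; exact natCast_add_two_le n
      _ = 4 * 4 ^ n := by rw [mul_pow, ← pow_mul, mul_comm n, pow_mul]; norm_num

lemma norm_eulerSigmaSeries_sub_le {q : ℂ} (hq : ‖q‖ ≤ 1 / 200) :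
    ‖eulerSigmaSeries q - q‖ ≤ 9 * ‖q‖ ^ 2 := by
  have h := norm_tsum_sub_linear_le (a := fun n ↦ (n * σ 1 n : ℂ)) (C := 8) (K := 8) (q := q)
    (by norm_num) (fun n ↦ ?_) (summable_eulerSigmaSeries (by linarith)) (by linarith)
  · simp only [ArithmeticFunction.map_zero, Nat.cast_zero, ArithmeticFunction.sigma_one,
      Nat.cast_one, zero_add, one_mul, mul_zero] at h
    refine h.trans ?_
    rw [div_le_iff₀ (by linarith)]
    nlinarith [sq_nonneg ‖q‖]
  · calc ‖((n + 2 : ℕ) * σ 1 (n + 2) : ℂ)‖ ≤ ((n + 2 : ℕ) : ℝ) ^ 3 :=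
        norm_natCast_mul_sigma_one_le (n + 2)
      _ ≤ (2 * 2 ^ n) ^ 3 := by gcongr; exact natCast_add_two_le n
      _ = 8 * 8 ^ n := by rw [mul_pow, ← pow_mul, mul_comm n, pow_mul]; norm_num

lemma norm_exp_two_pi_I_mul (z : ℍ) :
    ‖cexp (2 * Real.pi * I * z)‖ = Real.exp (-(2 * Real.pi * z.im)) := by
  rw [Complex.norm_exp]
  simp

lemma norm_nome_le {z : ℍ} (hz : 3 ≤ 4 * z.im ^ 2) : ‖cexp (2 * Real.pi * I * z)‖ ≤ 1 / 200 := by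
  have him : 0.866 ≤ z.im := by nlinarith [z.im_pos]
  have harg : 5.4 ≤ 2 * Real.pi * z.im := by nlinarith [Real.pi_gt_d2]
  have hfive : (2.71 : ℝ) ^ 5 ≤ Real.exp 5 := by
    rw [show (5 : ℝ) = ((5 : ℕ) : ℝ) * 1 by norm_num, Real.exp_nat_mul]
    gcongr
    linarith [Real.exp_one_gt_d9]
  have hfrac : (1.4 : ℝ) ≤ Real.exp 0.4 := by linarith [Real.add_one_le_exp (0.4 : ℝ)]
  have hexp : (200 : ℝ) ≤ Real.exp (2 * Real.pi * z.im) :=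
    calc (200 : ℝ) ≤ 2.71 ^ 5 * 1.4 := by norm_num
      _ ≤ Real.exp 5 * Real.exp 0.4 := by gcongr
      _ = Real.exp 5.4 := by rw [← Real.exp_add]; norm_num
      _ ≤ _ := Real.exp_le_exp.mpr harg
  rw [norm_exp_two_pi_I_mul, Real.exp_neg, one_div]
  gcongr

lemma im_lt_one_of_lt_norm_nome {z : ℍ} (hz : 1 / 300 < ‖cexp (2 * Real.pi * I * z)‖) :
    z.im < 1 := by
  by_contra! him
  have harg : 6 ≤ 2 * Real.pi * z.im := by nlinarith [Real.pi_gt_d2]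
  have hsix : (2.7 : ℝ) ^ 6 ≤ Real.exp 6 := by
    rw [show (6 : ℝ) = ((6 : ℕ) : ℝ) * 1 by norm_num, Real.exp_nat_mul]
    gcongr
    linarith [Real.exp_one_gt_d9]
  have hexp : (300 : ℝ) ≤ Real.exp (2 * Real.pi * z.im) :=
    (by norm_num : (300 : ℝ) ≤ 2.7 ^ 6).trans (hsix.trans (Real.exp_le_exp.mpr harg))
  rw [norm_exp_two_pi_I_mul, Real.exp_neg, one_div] at hz
  exact absurd (inv_anti₀ (by norm_num) hexp) hz.not_ge

/-- If `E₂² = 12 D E₂` (equivalently `E₄ = 0`) at a point of imaginary part at least `√3 / 2`,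
then this point has imaginary part less than `1` and `E₂` is close to `11 / 10` there. -/
lemma im_lt_one_and_norm_E2_sub_le {w : ℍ} (hw : 3 ≤ 4 * w.im ^ 2)
    (h : E2 w ^ 2 = 12 * D E2 w) : w.im < 1 ∧ ‖E2 w - 11 / 10‖ ≤ 1 / 50 := by
  have hE : E2 w = 1 - 24 * sigmaSeries (cexp (2 * Real.pi * I * w)) := by
    rw [← Ek_two_eq_E2, Ek_two_eq_sigmaSeries]
  have hq := norm_nome_le hw
  rw [normalizedDeriv_E2_eq_eulerSigmaSeries, hE] at h
  set q := cexp (2 * Real.pi * I * w)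
  have hs := norm_sigmaSeries_sub_le hq
  have ht := norm_eulerSigmaSeries_sub_le hq
  have hq2 : ‖q‖ ^ 2 ≤ 1 / 40000 := by nlinarith [norm_nonneg q]
  have hs' : ‖sigmaSeries q - q‖ ≤ 1 / 8000 := by linarith
  have ht' : ‖eulerSigmaSeries q - q‖ ≤ 9 / 40000 := by linarith
  have hsn : ‖sigmaSeries q‖ ≤ 6 / 1000 := by
    have := norm_sub_norm_le (sigmaSeries q) q
    linarith
  have hsn2 : ‖sigmaSeries q‖ ^ 2 ≤ 36 / 1000000 := by nlinarith [norm_nonneg (sigmaSeries q)]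
  have hid : 1 + 240 * q =
      48 * (sigmaSeries q - q) - 576 * sigmaSeries q ^ 2 - 288 * (eulerSigmaSeries q - q) := by
    linear_combination h
  have hlin : ‖1 + 240 * q‖ ≤ 1 / 10 := by
    rw [hid]
    refine (norm_sub_le _ _).trans ?_
    have h₁ := norm_sub_le (48 * (sigmaSeries q - q)) (576 * sigmaSeries q ^ 2)
    simp only [norm_mul, norm_pow, Complex.norm_ofNat] at h₁ ⊢
    linarith
  refine ⟨im_lt_one_of_lt_norm_nome ?_, ?_⟩
  · have h₁ : ‖(1 : ℂ)‖ ≤ ‖1 + 240 * q‖ + ‖240 * q‖ := by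
      simpa using norm_sub_le (1 + 240 * q) (240 * q)
    rw [norm_one, norm_mul, Complex.norm_ofNat] at h₁
    linarith
  · have h₂ : E2 w - 11 / 10 = -(1 / 10) * (1 + 240 * q) - 24 * (sigmaSeries q - q) := by
      rw [hE]; ring
    rw [h₂]
    refine (norm_sub_le _ _).trans ?_
    rw [norm_mul, norm_mul, Complex.norm_ofNat]
    norm_num
    linarith

lemma E2_smul (γ : SL(2, ℤ)) (z : ℍ) :
    E2 (γ • z) = denom γ z ^ 2 * E2 z - 6 * I / Real.pi * γ 1 0 * denom γ z := by
  have h := congrFun (E2_slash_action γ) z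
  rw [ModularForm.SL_slash_apply] at h
  simp only [Pi.sub_apply, Pi.smul_apply, smul_eq_mul, D2, riemannZeta_two] at h
  have hd := denom_ne_zero γ z
  have hpi : (Real.pi : ℂ) ≠ 0 := by exact_mod_cast Real.pi_ne_zero
  rw [zpow_neg, zpow_ofNat] at h
  field_simp at h ⊢
  linear_combination h

lemma normalizedDeriv_E2_slash (γ : SL(2, ℤ)) (z : ℍ) :
    D (E2 ∣[(2 : ℤ)] γ) z = D E2 z + 3 / Real.pi ^ 2 * (γ 1 0) ^ 2 / denom γ z ^ 2 := by
  have hden : HasDerivAt (fun x : ℂ ↦ γ 1 0 * x + γ 1 1) (γ 1 0 : ℂ) z := by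
    simpa using ((hasDerivAt_id (z : ℂ)).const_mul (γ 1 0 : ℂ)).add_const (γ 1 1 : ℂ)
  have hden0 : (γ 1 0 * z + γ 1 1 : ℂ) ≠ 0 := by
    simpa [denom_apply] using denom_ne_zero γ z
  have hE := (hasDerivAt_Ek_two z).differentiableAt.hasDerivAt
  have hF := hE.sub ((hden.inv hden0).const_mul (6 * I / Real.pi * γ 1 0))
  have heq : (E2 ∣[(2 : ℤ)] γ) ∘ ofComplex =ᶠ[nhds (z : ℂ)]
      Ek 2 - fun x ↦ 6 * I / Real.pi * γ 1 0 * (γ 1 0 * x + γ 1 1 : ℂ)⁻¹ := by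
    filter_upwards [isOpen_upperHalfPlaneSet.mem_nhds z.im_pos] with x hx
    have hx' : denom γ x = γ 1 0 * x + γ 1 1 := denom_apply γ ⟨x, hx⟩
    rw [E2_slash_action, Function.comp_apply, ofComplex_apply_of_im_pos hx]
    simp only [Pi.sub_apply, Pi.smul_apply, smul_eq_mul, D2, riemannZeta_two,
      ← Ek_two_eq_E2, hx']
    field_simp
  rw [Derivative.normalizedDerivOfComplex, heq.deriv_eq.trans hF.deriv, normalizedDeriv_E2_eq,
    denom_apply]
  field_simp
  ring

/-- The derivative of the transformation law of `E₂` at a multiple zero of `E₂`. -/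
lemma E2_smul_sq_eq {γ : SL(2, ℤ)} {z : ℍ} (h0 : E2 z = 0) (hd : D E2 z = 0) :
    E2 (γ • z) ^ 2 = 12 * D E2 (γ • z) := by
  have h := congrFun (Derivative.normalizedDerivOfComplex_SL_slash (k := 2) (γ := γ)
    E2_mdifferentiable) z
  have hm := denom_ne_zero γ z
  rw [normalizedDeriv_E2_slash, hd, Pi.sub_apply, ModularForm.SL_slash_apply,
    ModularForm.SL_slash_apply, E2_smul, h0, zpow_neg, zpow_neg,
    show (2 + 2 : ℤ) = (4 : ℕ) by norm_num, zpow_natCast, zpow_ofNat] at h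
  rw [E2_smul, h0]
  push_cast at h
  field_simp at h ⊢
  refine mul_right_cancel₀ I_ne_zero ?_
  ring_nf at h ⊢
  simp only [I_pow_three] at h ⊢
  linear_combination 12 * h

lemma normSq_E2_smul_mul_im {γ : SL(2, ℤ)} {z : ℍ} (h0 : E2 z = 0) :
    ‖E2 (γ • z)‖ ^ 2 * (Real.pi * (γ • z).im) = 6 * (E2 (γ • z)).re := by
  rw [ModularGroup.im_smul_eq_div_normSq, ← Complex.normSq_eq_norm_sq, E2_smul, h0]
  have hn := (normSq_denom_pos γ z.im_ne_zero).ne'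
  have him : (denom γ z).im = γ 1 0 * z.im := by simp [denom_apply]
  have hre : (6 * I / Real.pi * γ 1 0 * denom γ z).re =
      -(6 / Real.pi * γ 1 0 * (denom γ z).im) := by
    have : (6 * I / Real.pi * γ 1 0 * denom γ z) = ((6 / Real.pi * γ 1 0 : ℝ) : ℂ) *
      (I * denom γ z) := by push_cast; ring
    rw [this, re_ofReal_mul]; simp
  simp only [mul_zero, zero_sub, neg_re, hre, him, Complex.normSq_neg, map_mul, map_div₀,
    Complex.normSq_I, Complex.normSq_ofReal, Complex.normSq_ofNat, Complex.normSq_intCast]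
  field_simp

theorem stmt14 (a : ℂ) (ha : 0 < a.im) (h0 : Ek 2 a = 0) : deriv (Ek 2) a ≠ 0 := by
  intro hd
  let z : ℍ := ⟨a, ha⟩
  have hE : E2 z = 0 := (Ek_two_eq_E2 z).symm.trans h0
  have hD : D E2 z = 0 := by
    rw [normalizedDeriv_E2_eq]
    exact mul_eq_zero_of_right _ hd
  obtain ⟨γ, hγ⟩ := exists_smul_mem_fd z
  obtain ⟨him, hnorm⟩ := im_lt_one_and_norm_E2_sub_le (three_le_four_mul_im_sq_of_mem_fd hγ)
    (E2_smul_sq_eq hE hD)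
  have hkey := normSq_E2_smul_mul_im (γ := γ) hE
  have hre : 1.08 ≤ (E2 (γ • z)).re := by
    have h := (abs_le.mp ((Complex.abs_re_le_norm _).trans hnorm)).1
    have h' : (E2 (γ • z) - 11 / 10).re = (E2 (γ • z)).re - 11 / 10 := by
      rw [sub_re]; norm_num
    linarith
  have hle : ‖E2 (γ • z)‖ ≤ 1.12 := by
    have h := norm_sub_norm_le (E2 (γ • z)) (11 / 10)
    have h' : ‖(11 / 10 : ℂ)‖ = 11 / 10 := by norm_num
    linarith
  have hsq : ‖E2 (γ • z)‖ ^ 2 ≤ 1.12 ^ 2 := by gcongr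
  have hpi : Real.pi * (γ • z).im ≤ 3.15 := by nlinarith [Real.pi_lt_d2, Real.pi_pos]
  have hprod : ‖E2 (γ • z)‖ ^ 2 * (Real.pi * (γ • z).im) ≤ 1.12 ^ 2 * 3.15 := by
    have := (γ • z).im_pos
    gcongr
  linarith
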